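/- Let d, m, l ≥ 1 be natural numbers and ε ≥ 0. Let H₁, …, H_m be d×d complex matrices with 0 ≼ H_i ≼ I for each i, and let H = (1/m) Σ_{i ∈ Fin m} H_i. For a tuple k : Fin l → Fin m, let G(k) = (1/l) Σ_{j ∈ Fin l} H_{k(j)}. Then the number of tuples k ∈ (Fin m)^{Fin l} for which there exists a unit vector v ∈ ℂ^d with Re(vᴴ (H − G(k)) v) ≥ ε is at most d · exp(−ε² l / 8) · m^l. Equivalently, if k is drawn uniformly at random from (Fin m)^{Fin l}, then the probability that the largest eigenvalue of the Hermitian matrix H − G(k) is at least ε is at most d · exp(−ε² l / 8). -/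

import Mathlib

open Matrix
open scoped ComplexOrder Classical

namespace MatrixHoeffding

variable {n : Type*} [Fintype n] [DecidableEq n]

/-- The trace of a product of functions of two Hermitian matrices is a combination, with
nonnegative weights independent of the functions, of products of values at the eigenvalues. -/
lemma exists_weight_re_trace_cfc_mul_cfc {A B : Matrix n n ℂ}
    (hA : A.IsHermitian) (hB : B.IsHermitian) :
    ∃ w : n → n → ℝ, (∀ i j, 0 ≤ w i j) ∧ ∀ f g : ℝ → ℝ,
      (cfc f A * cfc g B).trace.re =
        ∑ i, ∑ j, w i j * (f (hA.eigenvalues i) * g (hB.eigenvalues j)) := by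
  set U : Matrix n n ℂ := (hA.eigenvectorUnitary : Matrix n n ℂ) with hU
  set V : Matrix n n ℂ := (hB.eigenvectorUnitary : Matrix n n ℂ) with hV
  refine ⟨fun i j => Complex.normSq ((star U * V) i j), fun i j => Complex.normSq_nonneg _, ?_⟩
  intro f g
  rw [hA.cfc_eq, hB.cfc_eq, IsHermitian.cfc, IsHermitian.cfc, Unitary.conjStarAlgAut_apply,
    Unitary.conjStarAlgAut_apply, ← hU, ← hV]
  set D := diagonal ((RCLike.ofReal : ℝ → ℂ) ∘ f ∘ hA.eigenvalues) with hD
  set E := diagonal ((RCLike.ofReal : ℝ → ℂ) ∘ g ∘ hB.eigenvalues) with hE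
  have key : (U * D * star U * (V * E * star V)).trace =
      (D * (star U * V) * (E * star (star U * V))).trace := by
    rw [Matrix.mul_assoc, Matrix.mul_assoc, Matrix.trace_mul_comm, star_mul, star_star]
    simp only [Matrix.mul_assoc]
  rw [key, Matrix.trace, Complex.re_sum]
  refine Finset.sum_congr rfl fun i _ => ?_
  rw [diag_apply, Matrix.mul_apply, Complex.re_sum]
  refine Finset.sum_congr rfl fun j _ => ?_
  rw [hD, hE, diagonal_mul, diagonal_mul, star_apply, Complex.star_def]
  simp only [Function.comp_apply, Complex.coe_algebraMap, Complex.normSq_apply, Complex.mul_re,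
    Complex.mul_im, Complex.conj_re, Complex.conj_im, RCLike.ofReal, Complex.ofReal_re,
    Complex.ofReal_im]
  ring

lemma posSemidef_cfc {A : Matrix n n ℂ} (hA : A.IsHermitian) {f : ℝ → ℝ}
    (hf : ∀ i, 0 ≤ f (hA.eigenvalues i)) : (cfc f A).PosSemidef := by
  rw [hA.cfc_eq, IsHermitian.cfc, Unitary.conjStarAlgAut_apply]
  refine PosSemidef.mul_mul_conjTranspose_same (PosSemidef.diagonal fun i => ?_) _
  simpa using hf i

/-- The real number `tr (exp A)` for a Hermitian matrix `A`. -/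
noncomputable def traceExp (A : Matrix n n ℂ) : ℝ := (cfc Real.exp A).trace.re

lemma traceExp_nonneg {A : Matrix n n ℂ} (hA : A.IsHermitian) : 0 ≤ traceExp A :=
  (Complex.le_def.mp (posSemidef_cfc hA fun _ => (Real.exp_pos _).le).trace_nonneg).1

lemma traceExp_zero : traceExp (0 : Matrix n n ℂ) = Fintype.card n := by
  simp [traceExp, cfc_apply_zero, Matrix.trace_one]

/-- The gradient inequality for the convex function `tr ∘ exp`. -/
lemma traceExp_le_add {A B : Matrix n n ℂ} (hA : A.IsHermitian) (hB : B.IsHermitian) :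
    traceExp B ≤ traceExp A + ((B - A) * cfc Real.exp B).trace.re := by
  obtain ⟨w, hw, hwf⟩ := exists_weight_re_trace_cfc_mul_cfc hA hB
  have hA' : IsSelfAdjoint A := hA
  have hB' : IsSelfAdjoint B := hB
  have h1 := hwf (fun _ => 1) Real.exp
  have h2 := hwf Real.exp (fun _ => 1)
  have h3 := hwf (fun _ => 1) (fun x => x * Real.exp x)
  have h4 := hwf (fun x => x) Real.exp
  rw [cfc_const_one ℝ A, one_mul] at h1 h3
  rw [cfc_const_one ℝ B, mul_one] at h2
  rw [cfc_mul (fun x => x) Real.exp B, cfc_id' ℝ B] at h3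
  rw [cfc_id' ℝ A] at h4
  rw [Matrix.sub_mul, Matrix.trace_sub, Complex.sub_re, traceExp, traceExp, h1, h2, h3, h4,
    ← sub_nonneg]
  simp only [← Finset.sum_add_distrib, ← Finset.sum_sub_distrib, ← mul_add, ← mul_sub]
  refine Finset.sum_nonneg fun i _ => Finset.sum_nonneg fun j _ => mul_nonneg (hw i j) ?_
  set a := hA.eigenvalues i
  set b := hB.eigenvalues j
  have h := Real.add_one_le_exp (a - b)
  have h' : Real.exp a = Real.exp (a - b) * Real.exp b := by rw [← Real.exp_add]; ring_nf
  nlinarith [mul_le_mul_of_nonneg_right h (Real.exp_pos b).le]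

lemma sub_mul_exp_sub_exp_le (b c : ℝ) :
    (b - c) * (Real.exp b - Real.exp c) ≤ (b - c) ^ 2 * (Real.exp b + Real.exp c) := by
  wlog h : c ≤ b generalizing b c
  · have := this c b (le_of_not_ge h)
    linarith
  have h1 := Real.add_one_le_exp (c - b)
  have h2 : Real.exp c = Real.exp (c - b) * Real.exp b := by rw [← Real.exp_add]; ring_nf
  have h3 : Real.exp b - Real.exp c ≤ (b - c) * (Real.exp b + Real.exp c) := by
    nlinarith [mul_le_mul_of_nonneg_right h1 (Real.exp_pos b).le,
      mul_nonneg (sub_nonneg.2 h) (Real.exp_pos c).le]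
  nlinarith [mul_le_mul_of_nonneg_left h3 (sub_nonneg.2 h)]

/-- A mean value inequality for the trace of the exponential. -/
lemma re_trace_sub_mul_exp_sub_exp_le {B C : Matrix n n ℂ}
    (hB : B.IsHermitian) (hC : C.IsHermitian) :
    ((B - C) * (cfc Real.exp B - cfc Real.exp C)).trace.re ≤
      ((B - C) * (B - C) * (cfc Real.exp B + cfc Real.exp C)).trace.re := by
  obtain ⟨w, hw, hwf⟩ := exists_weight_re_trace_cfc_mul_cfc hB hC
  have hB' : IsSelfAdjoint B := hB
  have hC' : IsSelfAdjoint C := hC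
  set P := cfc Real.exp B with hP
  set Q := cfc Real.exp C with hQ
  have e1 : ∀ M : Matrix n n ℂ, IsSelfAdjoint M →
      cfc (fun x => x * Real.exp x) M = M * cfc Real.exp M := fun M hM => by
    rw [cfc_mul (fun x => x) Real.exp M, cfc_id' ℝ M]
  have e2 : ∀ M : Matrix n n ℂ, IsSelfAdjoint M →
      cfc (fun x : ℝ => x * x) M = M * M := fun M hM => by
    rw [cfc_mul (fun x : ℝ => x) (fun x => x) M, cfc_id' ℝ M]
  have e3 : ∀ M : Matrix n n ℂ, IsSelfAdjoint M →
      cfc (fun x => x * (x * Real.exp x)) M = M * (M * cfc Real.exp M) := fun M hM => by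
    rw [cfc_mul (fun x => x) (fun x => x * Real.exp x) M, e1 M hM, cfc_id' ℝ M]
  have comm : ∀ M : Matrix n n ℂ, IsSelfAdjoint M →
      cfc Real.exp M * M = M * cfc Real.exp M := fun M hM => by
    have h := cfc_mul Real.exp (fun x => x) M
    rw [cfc_id' ℝ M] at h
    rw [← h, ← e1 M hM]
    simp only [mul_comm]
  have cP := comm B hB'
  have cQ := comm C hC'
  rw [← hP] at cP
  rw [← hQ] at cQ
  have l1 := hwf (fun x => x * Real.exp x) (fun _ => 1)
  have l2 := hwf (fun x => x) Real.exp
  have l3 := hwf Real.exp (fun x => x)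
  have l4 := hwf (fun _ => 1) (fun x => x * Real.exp x)
  have r1 := hwf (fun x => x * (x * Real.exp x)) (fun _ => 1)
  have r2 := hwf (fun x => x * x) Real.exp
  have r3 := hwf (fun x => x * Real.exp x) (fun x => x)
  have r4 := hwf (fun x => x) (fun x => x * Real.exp x)
  have r5 := hwf Real.exp (fun x => x * x)
  have r6 := hwf (fun _ => 1) (fun x => x * (x * Real.exp x))
  simp only [e1 B hB', e2 B hB', e3 B hB', e1 C hC', e2 C hC', e3 C hC', cfc_const_one ℝ B,
    cfc_const_one ℝ C, cfc_id' ℝ B, cfc_id' ℝ C, one_mul, mul_one, ← hP, ← hQ]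
    at l1 l2 l3 l4 r1 r2 r3 r4 r5 r6
  have hL : ((B - C) * (P - Q)).trace =
      (B * P).trace - (B * Q).trace - (P * C).trace + (C * Q).trace := by
    rw [Matrix.trace_mul_comm P C, ← Matrix.trace_sub, ← Matrix.trace_sub, ← Matrix.trace_add]
    congr 1
    noncomm_ring
  have hR : ((B - C) * (B - C) * (P + Q)).trace =
      (B * (B * P)).trace + (B * B * Q).trace - 2 * (B * P * C).trace - 2 * (B * (C * Q)).trace
        + (P * (C * C)).trace + (C * (C * Q)).trace := by
    have t1 : (B * C * P).trace = (B * P * C).trace := by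
      rw [Matrix.trace_mul_cycle, cP, Matrix.mul_assoc, ← Matrix.mul_assoc]
    have t2 : (C * B * P).trace = (B * P * C).trace := by
      rw [Matrix.mul_assoc, Matrix.trace_mul_comm]
    have t3 : (C * B * Q).trace = (B * (C * Q)).trace := by
      rw [Matrix.trace_mul_cycle, cQ, Matrix.trace_mul_comm]
    have t4 : (C * C * P).trace = (P * (C * C)).trace := Matrix.trace_mul_comm _ _
    have : (B - C) * (B - C) * (P + Q) = B * (B * P) + B * B * Q - B * C * P - C * B * P
        - B * (C * Q) - C * B * Q + C * C * P + C * (C * Q) := by noncomm_ring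
    rw [this]
    simp only [Matrix.trace_sub, Matrix.trace_add, t1, t2, t3, t4]
    ring
  rw [hL, hR]
  simp only [Complex.add_re, Complex.sub_re, Complex.mul_re, Complex.re_ofNat, Complex.im_ofNat,
    zero_mul, sub_zero, l1, l2, l3, l4, r1, r2, r3, r4, r5, r6]
  rw [← sub_nonneg]
  simp only [Finset.mul_sum, ← Finset.sum_add_distrib, ← Finset.sum_sub_distrib]
  refine Finset.sum_nonneg fun i _ => Finset.sum_nonneg fun j _ => ?_
  have h := mul_nonneg (hw i j)
    (sub_nonneg.2 (sub_mul_exp_sub_exp_le (hB.eigenvalues i) (hC.eigenvalues j)))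
  linarith

lemma re_trace_mul_cfc_exp_nonneg {M B : Matrix n n ℂ} (hM : M.PosSemidef)
    (hB : B.IsHermitian) : 0 ≤ (M * cfc Real.exp B).trace.re := by
  have hB' : IsSelfAdjoint B := hB
  set R := cfc (fun x => Real.exp (x / 2)) B with hR
  have hRR : cfc Real.exp B = R * R := by
    rw [hR, ← cfc_mul (fun x => Real.exp (x / 2)) (fun x => Real.exp (x / 2)) B]
    simp only [← Real.exp_add, add_halves]
  have hRh : Rᴴ = R :=
    (posSemidef_cfc (f := fun x => Real.exp (x / 2)) hB fun _ => (Real.exp_pos _).le).isHermitian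
  have h := (hM.mul_mul_conjTranspose_same R).trace_nonneg
  rw [hRh, Matrix.trace_mul_comm, ← Matrix.mul_assoc, Matrix.trace_mul_comm, ← hRR] at h
  exact (Complex.le_def.mp h).1

lemma posSemidef_one_sub_mul_self {D : Matrix n n ℂ} (h1 : (1 - D).PosSemidef)
    (h2 : (1 + D).PosSemidef) : (1 - D * D).PosSemidef := by
  have h3 := h2.mul_mul_conjTranspose_same (1 - D)
  have h4 := h1.mul_mul_conjTranspose_same (1 + D)
  rw [h1.isHermitian.eq] at h3
  rw [h2.isHermitian.eq] at h4
  have h5 := (h3.add h4).smul (show (0 : ℝ) ≤ 1 / 2 by norm_num)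
  convert h5 using 1
  have : (1 - D) * (1 + D) * (1 - D) + (1 + D) * (1 - D) * (1 + D) = (2 : ℝ) • (1 - D * D) := by
    rw [two_smul]
    noncomm_ring
  rw [this, smul_smul]
  norm_num

/-- Adding a centred random matrix with bounded differences increases the expected trace of the
exponential by a bounded factor. -/
lemma one_sub_sq_mul_sum_traceExp_le {ι : Type*} [Fintype ι] {A : Matrix n n ℂ}
    (hA : A.IsHermitian) {X : ι → Matrix n n ℂ} (hX : ∀ i, (X i).IsHermitian)
    (hsum : ∑ i, X i = 0)
    (hdiff : ∀ i j, (1 - (X i - X j) * (X i - X j)).PosSemidef) (t : ℝ) :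
    (1 - t ^ 2) * ∑ i, traceExp (A + t • X i) ≤ Fintype.card ι * traceExp A := by
  have hB : ∀ i, (A + t • X i).IsHermitian := fun i =>
    hA.add ((hX i).smul (IsSelfAdjoint.all t))
  set P : ι → Matrix n n ℂ := fun i => cfc Real.exp (A + t • X i) with hP
  set F := ∑ i, traceExp (A + t • X i) with hF
  set S := ∑ i, (X i * P i).trace.re with hS
  set m : ℝ := (Fintype.card ι : ℝ) with hm
  have step1 : F ≤ m * traceExp A + t * S := by
    have : ∀ i, traceExp (A + t • X i) ≤ traceExp A + t * (X i * P i).trace.re := fun i => by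
      have h := traceExp_le_add hA (hB i)
      rwa [add_sub_cancel_left, Matrix.smul_mul, Matrix.trace_smul, Complex.smul_re,
        smul_eq_mul] at h
    calc F ≤ ∑ i, (traceExp A + t * (X i * P i).trace.re) := Finset.sum_le_sum fun i _ => this i
      _ = _ := by simp [Finset.sum_add_distrib, Finset.mul_sum, hS, hm]
  have pair : ∀ i j, t * ((X i - X j) * (P i - P j)).trace.re ≤
      t ^ 2 * (traceExp (A + t • X i) + traceExp (A + t • X j)) := fun i j => by
    have h := re_trace_sub_mul_exp_sub_exp_le (hB i) (hB j)
    have h' : (A + t • X i) - (A + t • X j) = t • (X i - X j) := by rw [smul_sub]; abel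
    rw [h'] at h
    simp only [Matrix.smul_mul, Matrix.mul_smul, Matrix.trace_smul, Complex.smul_re,
      smul_eq_mul] at h
    have hi := re_trace_mul_cfc_exp_nonneg (hdiff i j) (hB i)
    have hj := re_trace_mul_cfc_exp_nonneg (hdiff i j) (hB j)
    rw [Matrix.sub_mul, Matrix.one_mul, Matrix.trace_sub, Complex.sub_re] at hi hj
    rw [Matrix.mul_add, Matrix.trace_add, Complex.add_re] at h
    simp only [traceExp]
    refine h.trans ?_
    rw [← mul_assoc, ← sq]
    exact mul_le_mul_of_nonneg_left (by linarith) (sq_nonneg t)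
  have cross1 : ∑ i, ∑ j, (X i * P j).trace.re = 0 := by
    rw [Finset.sum_comm]
    refine Finset.sum_eq_zero fun j _ => ?_
    rw [← Complex.re_sum, ← Matrix.trace_sum, ← Finset.sum_mul, hsum]
    simp
  have cross2 : ∑ i, ∑ j, (X j * P i).trace.re = 0 := by rw [Finset.sum_comm]; exact cross1
  have step2 : ∑ i, ∑ j, ((X i - X j) * (P i - P j)).trace.re = 2 * (m * S) := by
    have : ∀ i j, ((X i - X j) * (P i - P j)).trace.re = (X i * P i).trace.re
        - (X i * P j).trace.re - (X j * P i).trace.re + (X j * P j).trace.re := fun i j => by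
      rw [Matrix.sub_mul, Matrix.mul_sub, Matrix.mul_sub]
      simp only [Matrix.trace_sub, Complex.sub_re]
      ring
    simp only [this, Finset.sum_add_distrib, Finset.sum_sub_distrib, cross1, cross2]
    simp only [Finset.sum_const, Finset.card_univ, nsmul_eq_mul, ← Finset.mul_sum, ← hS, ← hm]
    ring
  have step3 : t * (m * S) ≤ t ^ 2 * (m * F) := by
    have h : ∑ i, ∑ j, t * ((X i - X j) * (P i - P j)).trace.re ≤
        ∑ i, ∑ j, t ^ 2 * (traceExp (A + t • X i) + traceExp (A + t • X j)) :=
      Finset.sum_le_sum fun i _ => Finset.sum_le_sum fun j _ => pair i j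
    simp only [← Finset.mul_sum, step2, Finset.sum_add_distrib, Finset.sum_const,
      Finset.card_univ, nsmul_eq_mul, ← hF, ← hm] at h
    linarith
  rcases isEmpty_or_nonempty ι with hι | hι
  · simp [hF, hm]
  · have hm0 : 0 < m := by rw [hm]; exact_mod_cast Fintype.card_pos
    have step4 : t * S ≤ t ^ 2 * F := by
      refine le_of_mul_le_mul_left ?_ hm0
      linarith
    linarith

lemma pow_mul_sum_traceExp_le {ι : Type*} [Fintype ι] {X : ι → Matrix n n ℂ}
    (hX : ∀ i, (X i).IsHermitian) (hsum : ∑ i, X i = 0)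
    (hdiff : ∀ i j, (1 - (X i - X j) * (X i - X j)).PosSemidef) {t : ℝ} (ht : 0 ≤ t)
    (ht1 : t ≤ 1) (l : ℕ) {A : Matrix n n ℂ} (hA : A.IsHermitian) :
    (1 - t ^ 2) ^ l * ∑ k : Fin l → ι, traceExp (A + t • ∑ j, X (k j)) ≤
      (Fintype.card ι : ℝ) ^ l * traceExp A := by
  have h0 : 0 ≤ 1 - t ^ 2 := by nlinarith
  induction l generalizing A with
  | zero => simp
  | succ l ih =>
    rw [← (Fin.consEquiv fun _ : Fin (l + 1) => ι).sum_comp, Fintype.sum_prod_type]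
    have e : ∀ (i : ι) (k : Fin l → ι),
        A + t • ∑ j, X ((Fin.consEquiv fun _ : Fin (l + 1) => ι) (i, k) j) =
          (A + t • X i) + t • ∑ j, X (k j) := fun i k => by
      simp [Fin.consEquiv, Fin.sum_univ_succ, smul_add, add_assoc]
    simp only [e]
    calc _ = (1 - t ^ 2) * ∑ i, ((1 - t ^ 2) ^ l *
          ∑ k : Fin l → ι, traceExp ((A + t • X i) + t • ∑ j, X (k j))) := by
          rw [← Finset.mul_sum]; ring
      _ ≤ (1 - t ^ 2) * ∑ i, ((Fintype.card ι : ℝ) ^ l * traceExp (A + t • X i)) :=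
          mul_le_mul_of_nonneg_left (Finset.sum_le_sum fun i _ =>
            ih (hA.add ((hX i).smul (IsSelfAdjoint.all t)))) h0
      _ = (Fintype.card ι : ℝ) ^ l * ((1 - t ^ 2) * ∑ i, traceExp (A + t • X i)) := by
          rw [← Finset.mul_sum]; ring
      _ ≤ (Fintype.card ι : ℝ) ^ l * (Fintype.card ι * traceExp A) :=
          mul_le_mul_of_nonneg_left (one_sub_sq_mul_sum_traceExp_le hA hX hsum hdiff t)
            (by positivity)
      _ = _ := by ring

lemma exp_le_traceExp {M : Matrix n n ℂ} (hM : M.IsHermitian) {v : n → ℂ}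
    (hv : star v ⬝ᵥ v = 1) {c : ℝ} (hc : c ≤ (star v ⬝ᵥ (M *ᵥ v)).re) :
    Real.exp c ≤ traceExp M := by
  have hM' : IsSelfAdjoint M := hM
  have hne : Nonempty n := by
    by_contra h
    rw [not_nonempty_iff] at h
    simp [dotProduct] at hv
  obtain ⟨i, hi⟩ := Finite.exists_max hM.eigenvalues
  have hpsd : (cfc (fun x => hM.eigenvalues i - x) M).PosSemidef :=
    posSemidef_cfc hM fun j => sub_nonneg.2 (hi j)
  rw [cfc_sub (fun _ => hM.eigenvalues i) (fun x => x) M, cfc_id' ℝ M,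
    cfc_const (hM.eigenvalues i) M, Algebra.algebraMap_eq_smul_one] at hpsd
  have h := (Complex.le_def.mp (hpsd.dotProduct_mulVec_nonneg v)).1
  rw [Matrix.sub_mulVec, dotProduct_sub, Matrix.smul_mulVec, Matrix.one_mulVec, dotProduct_smul,
    hv] at h
  simp only [Complex.sub_re, Complex.zero_re, Complex.smul_re, Complex.one_re, smul_eq_mul,
    mul_one, sub_nonneg] at h
  have htr : traceExp M = ∑ j, Real.exp (hM.eigenvalues j) := by
    rw [traceExp, hM.cfc_eq, IsHermitian.cfc, Unitary.conjStarAlgAut_apply, Matrix.trace_mul_cycle,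
      Unitary.coe_star_mul_self, Matrix.one_mul, Matrix.trace_diagonal, Complex.re_sum]
    exact Finset.sum_congr rfl fun j _ => Complex.ofReal_re _
  rw [htr]
  refine (Real.exp_le_exp.2 (hc.trans h)).trans ?_
  exact Finset.single_le_sum (f := fun j => Real.exp (hM.eigenvalues j))
    (fun j _ => (Real.exp_pos _).le) (Finset.mem_univ i)

end MatrixHoeffding

open MatrixHoeffding in
/-- **Matrix-Hoeffding counting bound for subsampled Hamiltonians.**
Let `0 ≼ H_i ≼ I` and `H = (1/m) ∑ᵢ H_i`.  For a tuple `k : Fin l → Fin m`, set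
`G(k) = (1/l) ∑ⱼ H_{k(j)}`.  Then the number of tuples `k` for which some unit vector `v`
has `Re(vᴴ (H − G(k)) v) ≥ ε` (i.e. the largest eigenvalue of `H − G(k)` is at least `ε`)
is at most `d · exp(−ε² l / 8) · m^l`. -/
theorem matrix_hoeffding_subsampling_count
    (d m l : ℕ) (hd : 1 ≤ d) (hm : 1 ≤ m) (hl : 1 ≤ l)
    (ε : ℝ) (hε : 0 ≤ ε)
    (H : Fin m → Matrix (Fin d) (Fin d) ℂ)
    (hpsd : ∀ i, (H i).PosSemidef)
    (hle1 : ∀ i, ((1 : Matrix (Fin d) (Fin d) ℂ) - H i).PosSemidef) :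
    ((Finset.univ.filter (fun k : Fin l → Fin m =>
        ∃ v : Fin d → ℂ, star v ⬝ᵥ v = 1 ∧
          (ε : ℝ) ≤ (star v ⬝ᵥ
            ((((1 / (m : ℝ)) • ∑ i, H i) - (1 / (l : ℝ)) • ∑ j, H (k j)) *ᵥ v)).re)).card
      : ℝ) ≤ d * Real.exp (-(ε ^ 2) * l / 8) * (m : ℝ) ^ l := by
  have hm0 : (m : ℝ) ≠ 0 := by positivity
  have hl0 : (l : ℝ) ≠ 0 := by positivity
  set Hbar := (1 / (m : ℝ)) • ∑ i, H i with hHbar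
  rcases lt_or_ge 1 ε with hε1 | hε1
  · rw [Finset.filter_false_of_mem]
    · simpa using by positivity
    rintro k - ⟨v, hv, hvε⟩
    have h1 : (1 - (Hbar - (1 / (l : ℝ)) • ∑ j, H (k j))).PosSemidef := by
      have h2 : ((1 / (m : ℝ)) • ∑ i, (1 - H i)).PosSemidef :=
        (posSemidef_sum _ fun i _ => hle1 i).smul (by positivity)
      have h3 : ((1 / (l : ℝ)) • ∑ j, H (k j)).PosSemidef :=
        (posSemidef_sum _ fun j _ => hpsd (k j)).smul (by positivity)
      convert h2.add h3 using 1
      rw [Finset.sum_sub_distrib, smul_sub, ← hHbar, Finset.sum_const, Finset.card_univ,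
        Fintype.card_fin, ← Nat.cast_smul_eq_nsmul ℝ, smul_smul, one_div_mul_cancel hm0, one_smul]
      abel
    have h4 := (Complex.le_def.mp (h1.dotProduct_mulVec_nonneg v)).1
    rw [Matrix.sub_mulVec 1, dotProduct_sub, Matrix.one_mulVec, hv, Complex.sub_re] at h4
    simp only [Complex.zero_re, Complex.one_re] at h4
    linarith
  set X : Fin m → Matrix (Fin d) (Fin d) ℂ := fun i => Hbar - H i with hXdef
  have hHh : ∀ i, (H i).IsHermitian := fun i => (hpsd i).isHermitian
  have hHbarh : Hbar.IsHermitian :=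
    ((posSemidef_sum _ fun i _ => hpsd i).smul (by positivity : (0 : ℝ) ≤ 1 / m)).isHermitian
  have hX : ∀ i, (X i).IsHermitian := fun i => hHbarh.sub (hHh i)
  have hsum : ∑ i, X i = 0 := by
    rw [hXdef, Finset.sum_sub_distrib, Finset.sum_const, Finset.card_univ, Fintype.card_fin,
      ← Nat.cast_smul_eq_nsmul ℝ, hHbar, smul_smul, mul_one_div_cancel hm0, one_smul, sub_self]
  have hdiff : ∀ i j, (1 - (X i - X j) * (X i - X j)).PosSemidef := fun i j => by
    apply posSemidef_one_sub_mul_self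
    · convert (hle1 j).add (hpsd i) using 1
      simp only [hXdef]; abel
    · convert (hle1 i).add (hpsd j) using 1
      simp only [hXdef]; abel
  set t := ε / 2 with ht
  have ht0 : 0 ≤ t := by positivity
  have key := pow_mul_sum_traceExp_le hX hsum hdiff ht0 (by linarith) l
    (isHermitian_zero (n := Fin d) (α := ℂ))
  simp only [zero_add, traceExp_zero, Fintype.card_fin] at key
  set S := Finset.univ.filter (fun k : Fin l → Fin m =>
        ∃ v : Fin d → ℂ, star v ⬝ᵥ v = 1 ∧
          (ε : ℝ) ≤ (star v ⬝ᵥ ((Hbar - (1 / (l : ℝ)) • ∑ j, H (k j)) *ᵥ v)).re) with hS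
  have hXS : ∀ k : Fin l → Fin m, t • ∑ j, X (k j) =
      (t * l) • (Hbar - (1 / (l : ℝ)) • ∑ j, H (k j)) := fun k => by
    rw [hXdef, Finset.sum_sub_distrib, Finset.sum_const, Finset.card_univ, Fintype.card_fin,
      ← Nat.cast_smul_eq_nsmul ℝ, mul_smul, smul_sub (l : ℝ), smul_smul (l : ℝ) (1 / (l : ℝ)),
      mul_one_div_cancel hl0, one_smul]
  have hherm : ∀ k : Fin l → Fin m, (t • ∑ j, X (k j)).IsHermitian := fun k =>
    IsHermitian.smul (isSelfAdjoint_sum _ fun j _ => hX (k j)) (IsSelfAdjoint.all t)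
  have markov : (S.card : ℝ) * Real.exp (t * l * ε) ≤
      ∑ k : Fin l → Fin m, traceExp (t • ∑ j, X (k j)) := by
    rw [← nsmul_eq_mul]
    refine (Finset.card_nsmul_le_sum S _ _ fun k hk => ?_).trans
      (Finset.sum_le_univ_sum_of_nonneg fun k => traceExp_nonneg (hherm k))
    obtain ⟨v, hv, hvε⟩ := (Finset.mem_filter.1 hk).2
    refine exp_le_traceExp (hherm k) hv ?_
    rw [hXS, Matrix.smul_mulVec, dotProduct_smul, Complex.smul_re, smul_eq_mul]
    exact mul_le_mul_of_nonneg_left hvε (by positivity)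
  have hbase : Real.exp (-(3 / 2) * t ^ 2) ≤ 1 - t ^ 2 := by
    have h1 := Real.add_one_le_exp (3 / 2 * t ^ 2)
    have h2 : Real.exp (-(3 / 2) * t ^ 2) * Real.exp (3 / 2 * t ^ 2) = 1 := by
      rw [← Real.exp_add]; simp
    have h3 : t ^ 2 ≤ 1 / 4 := by nlinarith
    have h4 : 1 ≤ (1 - t ^ 2) * (3 / 2 * t ^ 2 + 1) := by nlinarith [sq_nonneg t]
    refine le_of_mul_le_mul_right ?_ (Real.exp_pos (3 / 2 * t ^ 2))
    rw [h2]
    exact h4.trans (mul_le_mul_of_nonneg_left h1 (by linarith))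
  have hpow : Real.exp (-(3 / 2) * t ^ 2 * l) ≤ (1 - t ^ 2) ^ l := by
    rw [mul_comm, Real.exp_nat_mul]
    exact pow_le_pow_left₀ (Real.exp_pos _).le hbase l
  have hcomb : Real.exp (-(3 / 2) * t ^ 2 * l) * ((S.card : ℝ) * Real.exp (t * l * ε)) ≤
      (m : ℝ) ^ l * d :=
    (mul_le_mul hpow markov (by positivity) ((Real.exp_pos _).le.trans hpow)).trans key
  have hexp : Real.exp (-(3 / 2) * t ^ 2 * l) * Real.exp (t * l * ε) *
      Real.exp (-(ε ^ 2) * l / 8) = 1 := by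
    rw [← Real.exp_add, ← Real.exp_add, Real.exp_eq_one_iff, ht]
    ring
  calc (S.card : ℝ) = Real.exp (-(3 / 2) * t ^ 2 * l) * (S.card * Real.exp (t * l * ε)) *
        Real.exp (-(ε ^ 2) * l / 8) := by linear_combination -(S.card : ℝ) * hexp
    _ ≤ (m : ℝ) ^ l * d * Real.exp (-(ε ^ 2) * l / 8) :=
        mul_le_mul_of_nonneg_right hcomb (Real.exp_pos _).le
    _ = _ := by ring
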